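/- arXiv:1307.4973 — 2 statements merged into one kernel-verified Lean document; each statement's English description precedes it below -/
import Mathlib

section
/- Suppose there exist ν > 0, μ ∈ ℝ and symmetric positive definite matrices Q⁻ ∈ ℝ^{m×m}, Q⁺ ∈ ℝ^{(n−m)×(n−m)} such that, with 𝒬(x) = diag[e^{2μx} Q⁻, e^{−2μx} Q⁺], one has 𝒬(x)Λ = Λ𝒬(x) for all x ∈ [0,1], the inequality −2μ𝒬(x)Λ⁺ + Fᵀ𝒬(x) + 𝒬(x)F ≤ −2ν𝒬(x) holds for all x ∈ [0,1], and E₀ᵀ 𝒬(0) Λ E₀ ≤ E₁ᵀ 𝒬(1) Λ E₁, where E₀ = [[I_m, 0_{m,n−m}],[G₊₋, G₊₊]] and E₁ = [[G₋₋, G₋₊],[0_{n−m,m}, I_{n−m}]]. Then along every classical solution y of the hyperbolic system, the Lyapunov function V(t) = ∫₀¹ y(t,x)ᵀ 𝒬(x) y(t,x) dx satisfies V(t) ≤ e^{−2νt} V(0) for all t ≥ 0. -/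
open Matrix Set Real MeasureTheory

noncomputable section

/-- Loewner order on real matrices: `matLE A B` iff `B - A` is positive semidefinite. -/
def matLE {ι : Type*} [Fintype ι] (A B : Matrix ι ι ℝ) : Prop := (B - A).PosSemidef

/-- The product rule for `v ⬝ᵥ M *ᵥ v`. -/
lemma HasDerivWithinAt.dotProduct_mulVec_self {ι : Type*} [Fintype ι] {v : ℝ → ι → ℝ}
    {v' : ι → ℝ} {M : ℝ → Matrix ι ι ℝ} {M' : Matrix ι ι ℝ} {s : Set ℝ} {x : ℝ}
    (hv : HasDerivWithinAt v v' s x)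
    (hM : ∀ i j, HasDerivWithinAt (fun z => M z i j) (M' i j) s x) :
    HasDerivWithinAt (fun z => v z ⬝ᵥ M z *ᵥ v z)
      (v' ⬝ᵥ M x *ᵥ v x + v x ⬝ᵥ M' *ᵥ v x + v x ⬝ᵥ M x *ᵥ v') s x := by
  rw [hasDerivWithinAt_pi] at hv
  have h := HasDerivWithinAt.fun_sum (u := Finset.univ) fun i _ =>
    (hv i).mul (HasDerivWithinAt.fun_sum (u := Finset.univ) fun j _ => (hM i j).mul (hv j))
  refine h.congr_deriv ?_
  simp only [dotProduct, mulVec, ← Finset.sum_add_distrib, Pi.mul_apply, add_assoc]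
  simp only [Finset.sum_add_distrib, mul_add]

lemma ContinuousOn.dotProduct_mulVec {X ι : Type*} [TopologicalSpace X] [Fintype ι]
    {v w : X → ι → ℝ} {M : X → Matrix ι ι ℝ} {s : Set X}
    (hv : ContinuousOn v s) (hM : ContinuousOn M s) (hw : ContinuousOn w s) :
    ContinuousOn (fun z => v z ⬝ᵥ M z *ᵥ w z) s := by
  rw [continuousOn_iff_continuous_domRestrict] at *
  exact Continuous.dotProduct hv (Continuous.matrix_mulVec hM hw)

lemma Matrix.PosSemidef.dotProduct_mulVec_le {ι : Type*} [Fintype ι] {A B : Matrix ι ι ℝ}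
    (h : (B - A).PosSemidef) (v : ι → ℝ) : v ⬝ᵥ A *ᵥ v ≤ v ⬝ᵥ B *ᵥ v := by
  have := h.dotProduct_mulVec_nonneg v
  simp only [star_trivial, sub_mulVec, dotProduct_sub] at this
  linarith

/-- If the time derivative `g` of `f` has nonpositive space integral at all times, then the space
integral of `f` does not exceed its initial value. -/
lemma intervalIntegral_le_initial_of_integral_deriv_nonpos {f g : ℝ → ℝ → ℝ} {t : ℝ} (ht : 0 ≤ t)
    (hf : ContinuousOn (fun q : ℝ × ℝ => f q.1 q.2) (Ici 0 ×ˢ Icc 0 1))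
    (hg : ContinuousOn (fun q : ℝ × ℝ => g q.1 q.2) (Ici 0 ×ˢ Icc 0 1))
    (hfg : ∀ s ∈ Ici (0 : ℝ), ∀ x ∈ Icc (0 : ℝ) 1,
      HasDerivWithinAt (fun r => f r x) (g s x) (Ici 0) s)
    (hle : ∀ s ∈ Ici (0 : ℝ), ∫ x in (0 : ℝ)..1, g s x ≤ 0) :
    ∫ x in (0 : ℝ)..1, f t x ≤ ∫ x in (0 : ℝ)..1, f 0 x := by
  have hint : ∀ s ∈ Ici (0 : ℝ), IntervalIntegrable (fun x => f s x) volume 0 1 := fun s hs =>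
    ContinuousOn.intervalIntegrable <| by
      rw [uIcc_of_le zero_le_one]
      exact hf.comp (f := fun x => (s, x)) (by fun_prop) fun x hx => ⟨hs, hx⟩
  have hgi : IntegrableOn (fun q : ℝ × ℝ => g q.1 q.2) (Icc 0 t ×ˢ Icc 0 1) :=
    (hg.mono (prod_mono Icc_subset_Ici_self subset_rfl)).integrableOn_compact
      (isCompact_Icc.prod isCompact_Icc)
  have hftc : ∀ x ∈ Icc (0 : ℝ) 1, f t x - f 0 x = ∫ s in (0 : ℝ)..t, g s x := by
    intro x hx
    refine (intervalIntegral.integral_eq_sub_of_hasDerivAt_of_le ht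
      (f := fun s => f s x) ?_ ?_ ?_).symm
    · exact fun s hs => ((hfg s hs.1 x hx).continuousWithinAt).mono Icc_subset_Ici_self
    · exact fun s hs => (hfg s hs.1.le x hx).hasDerivAt (Ici_mem_nhds hs.1)
    · refine ContinuousOn.intervalIntegrable ?_
      rw [uIcc_of_le ht]
      exact hg.comp (f := fun s => (s, x)) (by fun_prop) fun s hs => ⟨hs.1, hx⟩
  have hswap : ∫ x in (0 : ℝ)..1, (∫ s in (0 : ℝ)..t, g s x)
      = ∫ s in (0 : ℝ)..t, ∫ x in (0 : ℝ)..1, g s x := by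
    simp only [intervalIntegral.integral_of_le ht, intervalIntegral.integral_of_le zero_le_one]
    refine (integral_integral_swap (f := g) ?_).symm
    rw [Measure.prod_restrict]
    exact hgi.mono_set (prod_mono Ioc_subset_Icc_self Ioc_subset_Icc_self)
  rw [← sub_nonpos, ← intervalIntegral.integral_sub (hint t ht) (hint 0 self_mem_Ici),
    intervalIntegral.integral_congr (g := fun x => ∫ s in (0 : ℝ)..t, g s x)
      (fun x hx => hftc x (by rwa [uIcc_of_le zero_le_one] at hx)), hswap]
  rw [← neg_nonneg, ← intervalIntegral.integral_neg]
  exact intervalIntegral.integral_nonneg ht fun s hs => neg_nonneg.2 (hle s hs.1)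

/-- Decay of the Lyapunov function `V(t) = ∫₀¹ yᵀ 𝒬(x) y dx` along classical solutions.
The state index is `Fin m ⊕ Fin p` with `n = m + p`. -/
theorem stmt_1
    (m p : ℕ) (hn : 1 ≤ m + p)
    (lam : (Fin m ⊕ Fin p) → ℝ)
    (hneg : ∀ k : Fin m, lam (Sum.inl k) < 0)
    (hpos : ∀ k : Fin p, 0 < lam (Sum.inr k))
    (F G : Matrix (Fin m ⊕ Fin p) (Fin m ⊕ Fin p) ℝ)
    (ν μ : ℝ) (hν : 0 < ν)
    (Qm : Matrix (Fin m) (Fin m) ℝ) (Qp : Matrix (Fin p) (Fin p) ℝ)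
    (hQm : Qm.PosDef) (hQp : Qp.PosDef)
    (Qx : ℝ → Matrix (Fin m ⊕ Fin p) (Fin m ⊕ Fin p) ℝ)
    (hQx : ∀ x : ℝ, Qx x =
      Matrix.fromBlocks (Real.exp (2 * μ * x) • Qm) 0 0 (Real.exp (-(2 * μ * x)) • Qp))
    (hcomm : ∀ x ∈ Icc (0:ℝ) 1,
      Qx x * Matrix.diagonal lam = Matrix.diagonal lam * Qx x)
    (hlmi1 : ∀ x ∈ Icc (0:ℝ) 1,
      matLE (-(2 * μ) • (Qx x * Matrix.diagonal (fun k => |lam k|))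
              + Fᵀ * Qx x + Qx x * F)
            (-(2 * ν) • Qx x))
    (hlmi2 :
      matLE ((Matrix.fromBlocks 1 0 G.toBlocks₂₁ G.toBlocks₂₂)ᵀ
               * (Qx 0 * Matrix.diagonal lam)
               * Matrix.fromBlocks 1 0 G.toBlocks₂₁ G.toBlocks₂₂)
            ((Matrix.fromBlocks G.toBlocks₁₁ G.toBlocks₁₂ 0 1)ᵀ
               * (Qx 1 * Matrix.diagonal lam)
               * Matrix.fromBlocks G.toBlocks₁₁ G.toBlocks₁₂ 0 1)) :
    ∀ y : ℝ → ℝ → (Fin m ⊕ Fin p) → ℝ,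
      -- `y` is C¹ on [0,∞) × [0,1]
      ContDiffOn ℝ 1 (fun q : ℝ × ℝ => y q.1 q.2) (Ici (0:ℝ) ×ˢ Icc (0:ℝ) 1) →
      -- the hyperbolic PDE ∂ₜ y + Λ ∂ₓ y = F y
      (∀ t ∈ Ici (0:ℝ), ∀ x ∈ Icc (0:ℝ) 1,
        fderivWithin ℝ (fun q : ℝ × ℝ => y q.1 q.2) (Ici (0:ℝ) ×ˢ Icc (0:ℝ) 1) (t, x) (1, 0)
          + (Matrix.diagonal lam).mulVec
              (fderivWithin ℝ (fun q : ℝ × ℝ => y q.1 q.2)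
                (Ici (0:ℝ) ×ˢ Icc (0:ℝ) 1) (t, x) (0, 1))
          = F.mulVec (y t x)) →
      -- the boundary condition (y⁻(t,1), y⁺(t,0)) = G (y⁻(t,0), y⁺(t,1))
      (∀ t ∈ Ici (0:ℝ),
        Sum.elim (fun k => y t 1 (Sum.inl k)) (fun k => y t 0 (Sum.inr k))
          = G.mulVec (Sum.elim (fun k => y t 0 (Sum.inl k)) (fun k => y t 1 (Sum.inr k)))) →
      -- the Lyapunov function V(t) = ∫₀¹ y(t,x)ᵀ 𝒬(x) y(t,x) dx decays as e^{-2νt}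
      ∀ t ≥ (0:ℝ),
        (∫ x in (0:ℝ)..1, (y t x) ⬝ᵥ ((Qx x).mulVec (y t x)))
          ≤ Real.exp (-(2 * ν) * t) * (∫ x in (0:ℝ)..1, (y 0 x) ⬝ᵥ ((Qx x).mulVec (y 0 x))) := by
  intro y hy hpde hbc t ht
  set S : Set (ℝ × ℝ) := Ici (0 : ℝ) ×ˢ Icc (0 : ℝ) 1 with hS
  set Y : ℝ × ℝ → (Fin m ⊕ Fin p) → ℝ := fun q => y q.1 q.2 with hY
  set yt : ℝ × ℝ → (Fin m ⊕ Fin p) → ℝ := fun q => fderivWithin ℝ Y S q (1, 0) with hyt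
  set yx : ℝ × ℝ → (Fin m ⊕ Fin p) → ℝ := fun q => fderivWithin ℝ Y S q (0, 1) with hyx
  have hSu : UniqueDiffOn ℝ S := (uniqueDiffOn_Ici 0).prod (uniqueDiffOn_Icc zero_lt_one)
  have hYc : ContinuousOn Y S := hy.continuousOn
  have hDc : ContinuousOn (fderivWithin ℝ Y S) S := hy.continuousOn_fderivWithin hSu le_rfl
  have hytc : ContinuousOn yt S := hDc.clm_apply continuousOn_const
  have hD : ∀ q ∈ S, HasFDerivWithinAt Y (fderivWithin ℝ Y S q) S q := fun q hq =>
    (hy.differentiableOn one_ne_zero q hq).hasFDerivWithinAt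
  have hdt : ∀ s ∈ Ici (0 : ℝ), ∀ x ∈ Icc (0 : ℝ) 1,
      HasDerivWithinAt (fun r => y r x) (yt (s, x)) (Ici 0) s := fun s hs x hx =>
    (hD (s, x) ⟨hs, hx⟩).comp_hasDerivWithinAt (f := fun r => (r, x)) s
      ((hasDerivWithinAt_id s _).prodMk (hasDerivWithinAt_const s _ x)) fun _ hr => mem_prod.2 ⟨hr, hx⟩
  have hdx : ∀ s ∈ Ici (0 : ℝ), ∀ x ∈ Icc (0 : ℝ) 1,
      HasDerivWithinAt (fun z => y s z) (yx (s, x)) (Icc 0 1) x := fun s hs x hx =>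
    (hD (s, x) ⟨hs, hx⟩).comp_hasDerivWithinAt (f := fun z => (s, z)) x
      ((hasDerivWithinAt_const x _ s).prodMk (hasDerivWithinAt_id x _)) fun _ hr => mem_prod.2 ⟨hs, hr⟩
  have hQc : Continuous Qx := by
    rw [funext hQx]
    exact Continuous.matrix_fromBlocks (by fun_prop) (by fun_prop) (by fun_prop) (by fun_prop)
  have hQc' : ContinuousOn (fun q : ℝ × ℝ => Qx q.2) S := (hQc.comp continuous_snd).continuousOn
  have hQd : ∀ x i j, HasDerivAt (fun z => (Qx z * diagonal lam) i j)
      ((-(2 * μ) • (Qx x * diagonal fun k => |lam k|)) i j) x := by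
    intro x i j
    have hlin : HasDerivAt (fun z : ℝ => 2 * μ * z) (2 * μ) x := by
      simpa using (hasDerivAt_id x).const_mul (2 * μ)
    simp only [hQx, mul_diagonal, Matrix.smul_apply, smul_eq_mul]
    rcases i with i | i <;> rcases j with j | j
    · simp only [fromBlocks_apply₁₁, Matrix.smul_apply, smul_eq_mul, abs_of_neg (hneg j)]
      exact ((hlin.exp.mul_const (Qm i j)).mul_const _).congr_deriv (by ring)
    · simpa using hasDerivAt_const x (0 : ℝ)
    · simpa using hasDerivAt_const x (0 : ℝ)
    · simp only [fromBlocks_apply₂₂, Matrix.smul_apply, smul_eq_mul, abs_of_pos (hpos j)]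
      exact ((hlin.fun_neg.exp.mul_const (Qp i j)).mul_const _).congr_deriv (by ring)
  have hflux : ∀ s ∈ Ici (0 : ℝ),
      y s 0 ⬝ᵥ (Qx 0 * diagonal lam) *ᵥ y s 0 ≤ y s 1 ⬝ᵥ (Qx 1 * diagonal lam) *ᵥ y s 1 := by
    intro s hs
    set w : (Fin m ⊕ Fin p) → ℝ :=
      Sum.elim (fun k => y s 0 (Sum.inl k)) (fun k => y s 1 (Sum.inr k)) with hw
    have hG := hbc s hs
    rw [← hw, ← fromBlocks_toBlocks G, fromBlocks_mulVec] at hG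
    have h0 : fromBlocks 1 0 G.toBlocks₂₁ G.toBlocks₂₂ *ᵥ w = y s 0 := by
      rw [fromBlocks_mulVec]
      funext k
      rcases k with k | k
      · simp [hw]
      · simpa using (congrFun hG (Sum.inr k)).symm
    have h1 : fromBlocks G.toBlocks₁₁ G.toBlocks₁₂ 0 1 *ᵥ w = y s 1 := by
      rw [fromBlocks_mulVec]
      funext k
      rcases k with k | k
      · simpa using (congrFun hG (Sum.inl k)).symm
      · simp [hw]
    have hquad : ∀ E M : Matrix (Fin m ⊕ Fin p) (Fin m ⊕ Fin p) ℝ,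
        w ⬝ᵥ (Eᵀ * M * E) *ᵥ w = (E *ᵥ w) ⬝ᵥ M *ᵥ (E *ᵥ w) := by
      intro E M
      rw [← mulVec_mulVec, ← mulVec_mulVec, dotProduct_mulVec, vecMul_transpose]
    have := PosSemidef.dotProduct_mulVec_le hlmi2 w
    rwa [hquad, hquad, h0, h1] at this
  have hmain := intervalIntegral_le_initial_of_integral_deriv_nonpos ht
    (f := fun s x => exp (2 * ν * s) * (y s x ⬝ᵥ Qx x *ᵥ y s x))
    (g := fun s x => exp (2 * ν * s) * (2 * ν * (y s x ⬝ᵥ Qx x *ᵥ y s x)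
      + (yt (s, x) ⬝ᵥ Qx x *ᵥ y s x + y s x ⬝ᵥ Qx x *ᵥ yt (s, x)))) ?_ ?_ ?_ ?_
  · simp only [intervalIntegral.integral_const_mul, mul_zero, exp_zero, one_mul] at hmain
    rw [neg_mul, Real.exp_neg, ← div_eq_inv_mul, le_div_iff₀ (exp_pos _), mul_comm]
    exact hmain
  · exact ContinuousOn.mul (by fun_prop) (hYc.dotProduct_mulVec hQc' hYc)
  · exact ContinuousOn.mul (by fun_prop) ((continuousOn_const.mul
      (hYc.dotProduct_mulVec hQc' hYc)).add ((hytc.dotProduct_mulVec hQc' hYc).add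
      (hYc.dotProduct_mulVec hQc' hytc)))
  · intro s hs x hx
    have hlin : HasDerivWithinAt (fun z : ℝ => 2 * ν * z) (2 * ν) (Ici 0) s := by
      simpa using (hasDerivWithinAt_id s (Ici 0)).const_mul (2 * ν)
    have hq := (hdt s hs x hx).dotProduct_mulVec_self (M := fun _ => Qx x) (M' := 0)
      fun i j => hasDerivWithinAt_const _ _ _
    refine (hlin.exp.mul hq).congr_deriv ?_
    rw [zero_mulVec, dotProduct_zero]
    ring
  · intro s hs
    have hφ : ∀ x ∈ Icc (0 : ℝ) 1, HasDerivWithinAt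
        (fun z => y s z ⬝ᵥ (Qx z * diagonal lam) *ᵥ y s z) _ (Icc 0 1) x := fun x hx =>
      (hdx s hs x hx).dotProduct_mulVec_self fun i j => (hQd x i j).hasDerivWithinAt
    have hφ' : ∀ x ∈ Icc (0 : ℝ) 1, HasDerivWithinAt (fun z => -(exp (2 * ν * s) *
        (y s z ⬝ᵥ (Qx z * diagonal lam) *ᵥ y s z))) _ (Icc 0 1) x := fun x hx =>
      ((hφ x hx).const_mul (exp (2 * ν * s))).neg
    refine (intervalIntegral.integral_le_sub_of_hasDeriv_right_of_le zero_le_one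
      (fun x hx => (hφ' x hx).continuousWithinAt)
      (fun x hx => ((hφ' x (Ioo_subset_Icc_self hx)).hasDerivAt
        (Icc_mem_nhds hx.1 hx.2)).hasDerivWithinAt) ?_ ?_).trans ?_
    · refine ContinuousOn.integrableOn_Icc ?_
      have hι : MapsTo (fun x : ℝ => (s, x)) (Icc 0 1) S := fun x hx => ⟨hs, hx⟩
      have hYs : ContinuousOn (fun x => y s x) (Icc 0 1) := hYc.comp (by fun_prop) hι
      have hyts : ContinuousOn (fun x => yt (s, x)) (Icc 0 1) := hytc.comp (by fun_prop) hι
      exact continuousOn_const.mul ((continuousOn_const.mul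
        (hYs.dotProduct_mulVec hQc.continuousOn hYs)).add
        ((hyts.dotProduct_mulVec hQc.continuousOn hYs).add
        (hYs.dotProduct_mulVec hQc.continuousOn hyts)))
    · intro x hx
      have hx' := Ioo_subset_Icc_self hx
      have hp : yt (s, x) = F *ᵥ y s x - diagonal lam *ᵥ yx (s, x) :=
        eq_sub_of_add_eq (hpde s hs x hx')
      have hlmi := PosSemidef.dotProduct_mulVec_le (hlmi1 x hx') (y s x)
      have hF : (F *ᵥ y s x) ⬝ᵥ Qx x *ᵥ y s x = y s x ⬝ᵥ (Fᵀ * Qx x) *ᵥ y s x := by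
        rw [← mulVec_mulVec, dotProduct_mulVec _ Fᵀ, vecMul_transpose]
      have hL : (diagonal lam *ᵥ yx (s, x)) ⬝ᵥ Qx x *ᵥ y s x
          = yx (s, x) ⬝ᵥ (Qx x * diagonal lam) *ᵥ y s x := by
        rw [hcomm x hx', ← mulVec_mulVec, dotProduct_mulVec _ (diagonal lam),
          ← mulVec_transpose, diagonal_transpose]
      simp only [add_mulVec, dotProduct_add, smul_mulVec, dotProduct_smul, smul_eq_mul] at hlmi
      rw [← mul_neg]
      refine mul_le_mul_of_nonneg_left ?_ (exp_pos _).le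
      rw [hp, sub_dotProduct, mulVec_sub, dotProduct_sub, hF, hL, mulVec_mulVec, mulVec_mulVec,
        smul_mulVec, dotProduct_smul, smul_eq_mul]
      linarith
    · have := mul_le_mul_of_nonneg_left (hflux s hs) (exp_pos (2 * ν * s)).le
      linarith
end
end

section
/- Assume there exist ν > 0 and diagonal positive definite matrices Q_i ∈ ℝ^{n×n}, i ∈ I, such that for all i ∈ I: F_iᵀQ_i + Q_iF_i ≤ −2νQ_i and G_iᵀQ_iΛ_i⁺G_i ≤ Q_iΛ_i⁺, and for all i,j ∈ I: S_iᵀQ_iS_i = S_jᵀQ_jS_j. Then the switched linear hyperbolic system (with possibly mode-dependent numbers m_i of negative characteristic velocities) is globally uniformly exponentially stable with respect to the set of all switching signals: there exist ν' > 0 and C > 0 such that for every switching signal σ and every classical solution w, ‖w(t,·)‖_{L²((0,1);ℝⁿ)} ≤ C e^{−ν't} ‖w(0,·)‖_{L²((0,1);ℝⁿ)} for all t ≥ 0. -/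
open Matrix Set Real

noncomputable section

section Energy

variable {n : ℕ}

/-- The derivative of `p ↦ e^{c p.1} ∑ₖ rₖ z(p)ₖ²` when `z` has derivative `z'` at `p`. -/
def weightedSqDeriv (c : ℝ) (r : Fin n → ℝ) (z : ℝ × ℝ → Fin n → ℝ)
    (z' : ℝ × ℝ → ℝ × ℝ →L[ℝ] (Fin n → ℝ)) (p : ℝ × ℝ) : ℝ × ℝ →L[ℝ] ℝ :=
  Real.exp (c * p.1) • ∑ k, (2 * r k * z p k) • (ContinuousLinearMap.proj k).comp (z' p)
    + (∑ k, r k * z p k ^ 2) • (Real.exp (c * p.1) * c) • ContinuousLinearMap.fst ℝ ℝ ℝ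

theorem hasFDerivAt_weightedSq (c : ℝ) (r : Fin n → ℝ) {z : ℝ × ℝ → Fin n → ℝ}
    {z' : ℝ × ℝ → ℝ × ℝ →L[ℝ] (Fin n → ℝ)} {p : ℝ × ℝ} (h : HasFDerivAt z (z' p) p) :
    HasFDerivAt (fun p => Real.exp (c * p.1) * ∑ k, r k * z p k ^ 2)
      (weightedSqDeriv c r z z' p) p := by
  have hexp : HasFDerivAt (fun p : ℝ × ℝ => Real.exp (c * p.1))
      ((Real.exp (c * p.1) * c) • ContinuousLinearMap.fst ℝ ℝ ℝ) p := by
    have := ((hasFDerivAt_fst (𝕜 := ℝ) (p := p)).const_mul c).exp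
    rwa [smul_smul] at this
  have hsum : HasFDerivAt (fun p => ∑ k, r k * z p k ^ 2)
      (∑ k, (2 * r k * z p k) • (ContinuousLinearMap.proj k).comp (z' p)) p := by
    refine HasFDerivAt.fun_sum fun k _ => ?_
    have hk : HasFDerivAt (fun p => z p k) ((ContinuousLinearMap.proj k).comp (z' p)) p :=
      (ContinuousLinearMap.proj (R := ℝ) (φ := fun _ : Fin n => ℝ) k).hasFDerivAt.comp p h
    refine ((hk.pow 2).const_mul (r k)).congr_fderiv ?_
    ext <;> simp <;> ring
  exact hexp.mul hsum

/-- Exponential decay of the weighted energy of a diagonal hyperbolic system on a time interval,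
under a dissipative source term and a nonnegative outgoing boundary flux. -/
theorem exp_mul_weighted_energy_le {z : ℝ × ℝ → Fin n → ℝ}
    {z' : ℝ × ℝ → ℝ × ℝ →L[ℝ] (Fin n → ℝ)} {lam q : Fin n → ℝ}
    {F : Matrix (Fin n) (Fin n) ℝ} {ν a b : ℝ} (hab : a ≤ b)
    (hc : ContinuousOn z (Icc a b ×ˢ Icc 0 1))
    (hd : ∀ p ∈ Ioo a b ×ˢ Ioo (0 : ℝ) 1, HasFDerivAt z (z' p) p)
    (hpde : ∀ p ∈ Icc a b ×ˢ Icc (0 : ℝ) 1, ∀ k,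
      z' p (1, 0) k + lam k * z' p (0, 1) k = (F *ᵥ z p) k)
    (hF : ∀ v : Fin n → ℝ, ∑ k, q k * v k * (F *ᵥ v) k ≤ -ν * ∑ k, q k * v k ^ 2)
    (hbd : ∀ t ∈ Icc a b,
      ∑ k, q k * lam k * z (t, 0) k ^ 2 ≤ ∑ k, q k * lam k * z (t, 1) k ^ 2) :
    Real.exp (2 * ν * b) * ∫ x in (0 : ℝ)..1, ∑ k, q k * z (b, x) k ^ 2
      ≤ Real.exp (2 * ν * a) * ∫ x in (0 : ℝ)..1, ∑ k, q k * z (a, x) k ^ 2 := by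
  have hIcc : Icc (a, (0 : ℝ)) (b, 1) = Icc a b ×ˢ Icc 0 1 := (Icc_prod_Icc _ _ _ _).symm
  have hzk : ∀ k, ContinuousOn (fun p => z p k) (Icc a b ×ˢ Icc (0 : ℝ) 1) := fun k =>
    (continuous_apply k).comp_continuousOn hc
  have hcont : ∀ r : Fin n → ℝ, ContinuousOn
      (fun p : ℝ × ℝ => Real.exp (2 * ν * p.1) * ∑ k, r k * z p k ^ 2)
      (Icc a b ×ˢ Icc 0 1) := fun r => by
    refine ContinuousOn.mul (by fun_prop) ?_
    exact continuousOn_finsetSum _ fun k _ => continuousOn_const.mul ((hzk k).pow 2)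
  have hdiv : ∀ p ∈ Icc a b ×ˢ Icc (0 : ℝ) 1,
      weightedSqDeriv (2 * ν) q z z' p (1, 0)
        + weightedSqDeriv (2 * ν) (fun k => q k * lam k) z z' p (0, 1)
      = Real.exp (2 * ν * p.1) *
        (2 * ∑ k, q k * z p k * (F *ᵥ z p) k + 2 * ν * ∑ k, q k * z p k ^ 2) := by
    intro p hp
    simp only [← hpde p hp]
    simp only [weightedSqDeriv, _root_.add_apply, _root_.smul_apply,
      _root_.sum_apply, ContinuousLinearMap.comp_apply,
      ContinuousLinearMap.proj_apply, ContinuousLinearMap.coe_fst', smul_eq_mul, mul_one,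
      mul_zero, add_zero]
    have hsum : ∑ k, 2 * q k * z p k * z' p (1, 0) k
        + ∑ k, 2 * (q k * lam k) * z p k * z' p (0, 1) k
        = 2 * ∑ k, q k * z p k * (z' p (1, 0) k + lam k * z' p (0, 1) k) := by
      rw [← Finset.sum_add_distrib, Finset.mul_sum]
      exact Finset.sum_congr rfl fun k _ => by ring
    linear_combination Real.exp (2 * ν * p.1) * hsum
  have hdivc : ContinuousOn (fun p : ℝ × ℝ => Real.exp (2 * ν * p.1) *
        (2 * ∑ k, q k * z p k * (F *ᵥ z p) k + 2 * ν * ∑ k, q k * z p k ^ 2))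
      (Icc a b ×ˢ Icc (0 : ℝ) 1) := by
    have hFz : ContinuousOn (fun p => F *ᵥ z p) (Icc a b ×ˢ Icc (0 : ℝ) 1) :=
      (Continuous.matrix_mulVec continuous_const continuous_id).comp_continuousOn hc
    have hFk : ∀ k, ContinuousOn (fun p => (F *ᵥ z p) k) (Icc a b ×ˢ Icc (0 : ℝ) 1) := fun k =>
      (continuous_apply k).comp_continuousOn hFz
    fun_prop
  have hdivi : MeasureTheory.IntegrableOn (fun p => weightedSqDeriv (2 * ν) q z z' p (1, 0)
      + weightedSqDeriv (2 * ν) (fun k => q k * lam k) z z' p (0, 1))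
      (Icc (a, (0 : ℝ)) (b, 1)) := by
    rw [hIcc]
    refine (hdivc.integrableOn_compact (isCompact_Icc.prod isCompact_Icc)).congr_fun
      (fun p hp => (hdiv p hp).symm) (measurableSet_Icc.prod measurableSet_Icc)
  have key := MeasureTheory.integral_divergence_prod_Icc_of_hasFDerivAt_of_le
    (fun p => Real.exp (2 * ν * p.1) * ∑ k, q k * z p k ^ 2)
    (fun p => Real.exp (2 * ν * p.1) * ∑ k, q k * lam k * z p k ^ 2)
    (weightedSqDeriv (2 * ν) q z z') (weightedSqDeriv (2 * ν) (fun k => q k * lam k) z z')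
    (a, 0) (b, 1) ⟨hab, zero_le_one⟩ (hIcc ▸ hcont q) (hIcc ▸ hcont _)
    (fun p hp => hasFDerivAt_weightedSq _ _ (hd p hp))
    (fun p hp => hasFDerivAt_weightedSq _ _ (hd p hp)) hdivi
  have hneg : ∫ p in Icc (a, (0 : ℝ)) (b, 1), weightedSqDeriv (2 * ν) q z z' p (1, 0)
      + weightedSqDeriv (2 * ν) (fun k => q k * lam k) z z' p (0, 1) ≤ 0 := by
    refine MeasureTheory.setIntegral_nonpos measurableSet_Icc fun p hp => ?_
    rw [hdiv p (hIcc ▸ hp)]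
    exact mul_nonpos_of_nonneg_of_nonpos (Real.exp_pos _).le (by linarith [hF (z p)])
  have hint : ∀ y ∈ Icc (0 : ℝ) 1, IntervalIntegrable
      (fun t => Real.exp (2 * ν * t) * ∑ k, q k * lam k * z (t, y) k ^ 2)
      MeasureTheory.volume a b := fun y hy => by
    refine ContinuousOn.intervalIntegrable_of_Icc hab ?_
    exact (hcont fun k => q k * lam k).comp (f := fun t : ℝ => (t, y)) (by fun_prop)
      fun t ht => ⟨ht, hy⟩
  have hflux := intervalIntegral.integral_mono_on hab (hint 0 (by simp)) (hint 1 (by simp))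
    fun t ht => mul_le_mul_of_nonneg_left (hbd t ht) (Real.exp_pos _).le
  simp only [intervalIntegral.integral_const_mul] at key hflux
  linarith

/-- The flux balance at the boundary implied by a dissipative reflection matrix `G`. -/
theorem boundary_flux_le {m : ℕ} {lam q : Fin n → ℝ} {G : Matrix (Fin n) (Fin n) ℝ}
    (hlam : ∀ k : Fin n, if (k : ℕ) < m then lam k < 0 else 0 < lam k)
    (hG : ∀ v : Fin n → ℝ, ∑ k, q k * |lam k| * (G *ᵥ v) k ^ 2 ≤ ∑ k, q k * |lam k| * v k ^ 2)
    {u v : Fin n → ℝ}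
    (huv : (Matrix.of fun k l : Fin n =>
        if (l : ℕ) < m then -(G k l) else if k = l then (1:ℝ) else 0) *ᵥ u
      + (Matrix.of fun k l : Fin n =>
        if (l : ℕ) < m then (if k = l then (1:ℝ) else 0) else -(G k l)) *ᵥ v = 0) :
    ∑ k, q k * lam k * u k ^ 2 ≤ ∑ k, q k * lam k * v k ^ 2 := by
  have hin : ∀ k : Fin n, (G *ᵥ fun l => if (l : ℕ) < m then u l else v l) k
      = if (k : ℕ) < m then v k else u k := fun k => by
    have hk := congrFun huv k
    have hδ : (∑ l, if k = l then (if (l : ℕ) < m then v l else u l) else 0)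
        = if (k : ℕ) < m then v k else u k := by simp
    simp only [Pi.add_apply, mulVec, dotProduct, of_apply, Pi.zero_apply,
      ← Finset.sum_add_distrib] at hk ⊢
    rw [← hδ, ← sub_eq_zero, ← Finset.sum_sub_distrib, ← neg_eq_zero, ← Finset.sum_neg_distrib]
    refine Eq.trans ?_ hk
    refine Finset.sum_congr rfl fun l _ => ?_
    split_ifs <;> ring
  have h := hG fun l => if (l : ℕ) < m then u l else v l
  simp only [hin] at h
  rw [← sub_nonneg, ← Finset.sum_sub_distrib] at h ⊢
  refine h.trans_eq (Finset.sum_congr rfl fun k _ => ?_)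
  have := hlam k
  split_ifs at this ⊢
  · rw [abs_of_neg this]; ring
  · rw [abs_of_pos this]

/-- A matrix is bounded with respect to sums of squares. -/
theorem exists_sum_sq_mulVec_le (M : Matrix (Fin n) (Fin n) ℝ) :
    ∃ K > 0, ∀ v : Fin n → ℝ, ∑ k, (M *ᵥ v) k ^ 2 ≤ K * ∑ k, v k ^ 2 := by
  refine ⟨∑ k, ∑ l, M k l ^ 2 + 1, by positivity, fun v => ?_⟩
  have h : ∑ k, (M *ᵥ v) k ^ 2 ≤ ∑ k, (∑ l, M k l ^ 2) * ∑ l, v l ^ 2 :=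
    Finset.sum_le_sum fun k _ =>
      Finset.sum_mul_sq_le_sq_mul_sq Finset.univ (M k) v
  rw [← Finset.sum_mul] at h
  have : 0 ≤ ∑ k, v k ^ 2 := by positivity
  linarith

theorem sum_mul_sq_eq_dotProduct (r v : Fin n → ℝ) :
    ∑ k, r k * v k ^ 2 = v ⬝ᵥ diagonal r *ᵥ v := by
  simp only [dotProduct, mulVec_diagonal]
  exact Finset.sum_congr rfl fun k _ => by ring

theorem dotProduct_mulVec_le_of_matLE {M N : Matrix (Fin n) (Fin n) ℝ} (h : matLE M N)
    (v : Fin n → ℝ) : v ⬝ᵥ M *ᵥ v ≤ v ⬝ᵥ N *ᵥ v := by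
  have := h.dotProduct_mulVec_nonneg v
  rw [sub_mulVec, dotProduct_sub] at this
  simpa using this

theorem sum_mul_sq_mulVec_eq (r v : Fin n → ℝ) (M : Matrix (Fin n) (Fin n) ℝ) :
    ∑ k, r k * (M *ᵥ v) k ^ 2 = v ⬝ᵥ (Mᵀ * diagonal r * M) *ᵥ v := by
  rw [sum_mul_sq_eq_dotProduct, ← mulVec_mulVec, ← mulVec_mulVec, dotProduct_mulVec v Mᵀ,
    vecMul_transpose]

theorem sum_mul_mulVec_eq (r v : Fin n → ℝ) (F : Matrix (Fin n) (Fin n) ℝ) :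
    2 * ∑ k, r k * v k * (F *ᵥ v) k = v ⬝ᵥ (Fᵀ * diagonal r + diagonal r * F) *ᵥ v := by
  rw [add_mulVec, dotProduct_add, ← mulVec_mulVec, ← mulVec_mulVec, dotProduct_mulVec v Fᵀ,
    vecMul_transpose]
  simp only [dotProduct, mulVec_diagonal, ← Finset.sum_add_distrib, Finset.mul_sum]
  exact Finset.sum_congr rfl fun k _ => by ring

/-- A function that does not increase on intervals whose interior avoids a locally finite set
does not increase at all. -/
theorem le_of_forall_free_interval {E : ℝ → ℝ} {times : Set ℝ}
    (hfin : ∀ T : ℝ, (times ∩ Icc 0 T).Finite)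
    (hE : ∀ a b : ℝ, 0 ≤ a → a < b → (∀ u, a < u → u < b → u ∉ times) → E b ≤ E a)
    {s t : ℝ} (hs : 0 ≤ s) (hst : s ≤ t) : E t ≤ E s := by
  have hfin' : ∀ s t : ℝ, 0 ≤ s → (times ∩ Ioo s t).Finite := fun s t hs =>
    (hfin t).subset (inter_subset_inter_right _ fun u hu => ⟨hs.trans hu.1.le, hu.2.le⟩)
  induction hN : (times ∩ Ioo s t).ncard using Nat.strong_induction_on generalizing s t with
  | _ N ih =>
    rcases hst.eq_or_lt with rfl | hlt
    · rfl
    by_cases hfree : ∀ u, s < u → u < t → u ∉ times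
    · exact hE s t hs hlt hfree
    push Not at hfree
    obtain ⟨u, hsu, hut, hu⟩ := hfree
    have hcard : ∀ s' t', s ≤ s' → t' ≤ t → u ∉ Ioo s' t' →
        (times ∩ Ioo s' t').ncard < N := fun s' t' hs' ht' hu' => by
      rw [← hN]
      refine ncard_lt_ncard ⟨inter_subset_inter_right _ (Ioo_subset_Ioo hs' ht'), fun hsub => ?_⟩
        (hfin' s t hs)
      exact hu' (hsub ⟨hu, hsu, hut⟩).2
    exact (ih _ (hcard u t hsu.le le_rfl (by simp)) (hs.trans hsu.le) hut.le rfl).trans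
      (ih _ (hcard s u le_rfl hut.le (by simp)) hs hsu.le rfl)

end Energy

/-- Theorem (mode dependent sign structure, arbitrary switching):
the numbers `m i` of negative characteristic velocities may depend on the mode; under the
stated matrix conditions the switched linear hyperbolic system is globally uniformly
exponentially stable with respect to all switching signals.
A switching signal is encoded by its values `sig : ℝ → I` together with its set `times`
of switching times (its discontinuities), and a classical solution is a continuous
function which is C¹ and satisfies the PDE and boundary conditions of the active mode
on every interval free of switching times. -/
theorem stmt_7
    (n : ℕ) (hn : 1 ≤ n) (I : Type) [Fintype I] [Nonempty I]
    (m : I → ℕ) (hm : ∀ i, m i ≤ n)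
    (S : I → Matrix (Fin n) (Fin n) ℝ) (hS : ∀ i, IsUnit (S i))
    (lam : I → Fin n → ℝ)
    (hlam : ∀ i (k : Fin n), if (k : ℕ) < m i then lam i k < 0 else 0 < lam i k)
    (A L F : I → Matrix (Fin n) (Fin n) ℝ)
    (hL : ∀ i, L i = (S i)⁻¹ * Matrix.diagonal (lam i) * S i)
    (hF : ∀ i, F i = S i * A i * (S i)⁻¹)
    (G : I → Matrix (Fin n) (Fin n) ℝ)
    (B0 B1 : I → Matrix (Fin n) (Fin n) ℝ)
    -- B⁰ᵢ = [[-Gᵢ₋₋, 0],[-Gᵢ₊₋, I]] Sᵢ  and  B¹ᵢ = [[I, -Gᵢ₋₊],[0, -Gᵢ₊₊]] Sᵢ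
    (hB0 : ∀ i, B0 i = (Matrix.of fun k l : Fin n =>
        if (l : ℕ) < m i then -(G i k l) else if k = l then (1:ℝ) else 0) * S i)
    (hB1 : ∀ i, B1 i = (Matrix.of fun k l : Fin n =>
        if (l : ℕ) < m i then (if k = l then (1:ℝ) else 0) else -(G i k l)) * S i)
    (ν : ℝ) (hν : 0 < ν)
    (q : I → Fin n → ℝ) (hq : ∀ i k, 0 < q i k)
    -- FᵢᵀQᵢ + QᵢFᵢ ≤ -2νQᵢ
    (hlmi1 : ∀ i,
      matLE ((F i)ᵀ * Matrix.diagonal (q i) + Matrix.diagonal (q i) * F i)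
            (-(2 * ν) • Matrix.diagonal (q i)))
    -- GᵢᵀQᵢΛᵢ⁺Gᵢ ≤ QᵢΛᵢ⁺
    (hlmi2 : ∀ i,
      matLE ((G i)ᵀ * (Matrix.diagonal (q i) * Matrix.diagonal (fun k => |lam i k|)) * G i)
            (Matrix.diagonal (q i) * Matrix.diagonal (fun k => |lam i k|)))
    -- SᵢᵀQᵢSᵢ = SⱼᵀQⱼSⱼ
    (heq : ∀ i j,
      (S i)ᵀ * Matrix.diagonal (q i) * S i = (S j)ᵀ * Matrix.diagonal (q j) * S j) :
    ∃ ν' > (0:ℝ), ∃ C > (0:ℝ),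
      ∀ (sig : ℝ → I) (times : Set ℝ),
        -- switching times are positive and locally finite
        (∀ t ∈ times, 0 < t) →
        (∀ T : ℝ, (times ∩ Icc 0 T).Finite) →
        -- `sig` is constant (hence right-continuous) between switching times
        (∀ s t : ℝ, 0 ≤ s → s ≤ t → (∀ u, s < u → u ≤ t → u ∉ times) → sig t = sig s) →
        -- switching times are genuine discontinuities of `sig`
        (∀ t ∈ times, ∀ ε > (0:ℝ), ∃ s, t - ε < s ∧ s < t ∧ sig s ≠ sig t) →
        ∀ w : ℝ → ℝ → Fin n → ℝ,
          -- `w` is continuous on [0,∞) × [0,1]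
          ContinuousOn (fun pt : ℝ × ℝ => w pt.1 pt.2) (Ici (0:ℝ) ×ˢ Icc (0:ℝ) 1) →
          -- on every interval free of switching times, `w` is C¹ and satisfies the PDE
          -- and the boundary conditions of the active mode
          (∀ a b : ℝ, 0 ≤ a → a < b → (∀ u, a < u → u < b → u ∉ times) →
            ContDiffOn ℝ 1 (fun pt : ℝ × ℝ => w pt.1 pt.2) (Icc a b ×ˢ Icc (0:ℝ) 1) ∧
            (∀ t ∈ Icc a b, ∀ x ∈ Icc (0:ℝ) 1,
              fderivWithin ℝ (fun pt : ℝ × ℝ => w pt.1 pt.2)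
                  (Icc a b ×ˢ Icc (0:ℝ) 1) (t, x) (1, 0)
                + (L (sig a)).mulVec
                    (fderivWithin ℝ (fun pt : ℝ × ℝ => w pt.1 pt.2)
                      (Icc a b ×ˢ Icc (0:ℝ) 1) (t, x) (0, 1))
                = (A (sig a)).mulVec (w t x)) ∧
            (∀ t ∈ Icc a b,
              (B0 (sig a)).mulVec (w t 0) + (B1 (sig a)).mulVec (w t 1) = 0)) →
          ∀ t ≥ (0:ℝ),
            Real.sqrt (∫ x in (0:ℝ)..1, ∑ k, (w t x k) ^ 2)
              ≤ C * Real.exp (-ν' * t) * Real.sqrt (∫ x in (0:ℝ)..1, ∑ k, (w 0 x k) ^ 2) := by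
  classical
  obtain ⟨i₀⟩ := ‹Nonempty I›
  have hSdet : ∀ i, IsUnit (S i).det := fun i => (isUnit_iff_isUnit_det _).1 (hS i)
  set M : Matrix (Fin n) (Fin n) ℝ := diagonal (fun k => √(q i₀ k)) * S i₀ with hM
  have hMunit : IsUnit M.det := by
    rw [hM, det_mul, det_diagonal]
    refine IsUnit.mul (isUnit_iff_ne_zero.2 ?_) (hSdet i₀)
    exact Finset.prod_ne_zero_iff.2 fun k _ => (Real.sqrt_pos.2 (hq i₀ k)).ne'
  have hMsq : ∀ v, ∑ k, (M *ᵥ v) k ^ 2 = ∑ k, q i₀ k * (S i₀ *ᵥ v) k ^ 2 := fun v => by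
    refine Finset.sum_congr rfl fun k _ => ?_
    rw [hM, ← mulVec_mulVec, mulVec_diagonal, mul_pow, Real.sq_sqrt (hq i₀ k).le]
  obtain ⟨K₁, hK₁, hup⟩ := exists_sum_sq_mulVec_le M
  obtain ⟨K₂, hK₂, hlow⟩ := exists_sum_sq_mulVec_le M⁻¹
  refine ⟨ν, hν, √(K₂ * K₁), by positivity, ?_⟩
  intro sig times _ hfin _ _ w hwc hw t ht
  set V : ℝ → ℝ := fun t => ∫ x in (0 : ℝ)..1, ∑ k, q i₀ k * (S i₀ *ᵥ w t x) k ^ 2 with hV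
  have hVi : ∀ i v, ∑ k, q i k * (S i *ᵥ v) k ^ 2 = ∑ k, q i₀ k * (S i₀ *ᵥ v) k ^ 2 :=
    fun i v => by rw [sum_mul_sq_mulVec_eq, sum_mul_sq_mulVec_eq, heq i i₀]
  have hdecay : ∀ a b : ℝ, 0 ≤ a → a < b → (∀ u, a < u → u < b → u ∉ times) →
      Real.exp (2 * ν * b) * V b ≤ Real.exp (2 * ν * a) * V a := by
    intro a b ha hab hfree
    obtain ⟨hC1, hpde, hbc⟩ := hw a b ha hab hfree
    set i := sig a
    have hT : ∀ p ∈ Ioo a b ×ˢ Ioo (0 : ℝ) 1, Icc a b ×ˢ Icc (0 : ℝ) 1 ∈ nhds p := fun p hp =>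
      prod_mem_nhds (Icc_mem_nhds hp.1.1 hp.1.2) (Icc_mem_nhds hp.2.1 hp.2.2)
    let Scl : (Fin n → ℝ) →L[ℝ] (Fin n → ℝ) := LinearMap.toContinuousLinearMap (S i).mulVecLin
    have h := exp_mul_weighted_energy_le (z := fun p => S i *ᵥ w p.1 p.2)
      (z' := fun p => Scl.comp (fderivWithin ℝ (fun pt : ℝ × ℝ => w pt.1 pt.2)
        (Icc a b ×ˢ Icc (0 : ℝ) 1) p)) (lam := lam i) (q := q i) (F := F i) (ν := ν) hab.le
      (Scl.continuous.comp_continuousOn hC1.continuousOn) ?_ ?_ ?_ ?_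
    · simpa only [hVi] using h
    · intro p hp
      have hdw := (hC1.differentiableOn one_ne_zero).differentiableAt (hT p hp)
      have := Scl.hasFDerivAt.comp p hdw.hasFDerivAt
      rwa [← fderivWithin_of_mem_nhds (hT p hp)] at this
    · intro p hp k
      have h1 := congrArg (S i *ᵥ ·) (hpde p.1 hp.1 p.2 hp.2)
      simp only [mulVec_add, mulVec_mulVec] at h1
      have hSL : S i * L i = diagonal (lam i) * S i := by
        rw [hL, ← mul_assoc, ← mul_assoc, mul_nonsing_inv _ (hSdet i), one_mul]
      have hFS : F i * S i = S i * A i := by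
        rw [hF, mul_assoc, nonsing_inv_mul _ (hSdet i), mul_one]
      rw [hSL, ← hFS, ← mulVec_mulVec, ← mulVec_mulVec] at h1
      have h2 := congrFun h1 k
      simp only [Pi.add_apply, mulVec_diagonal] at h2
      exact h2
    · intro v
      have h1 := dotProduct_mulVec_le_of_matLE (hlmi1 i) v
      rw [← sum_mul_mulVec_eq, smul_mulVec, dotProduct_smul, smul_eq_mul,
        ← sum_mul_sq_eq_dotProduct] at h1
      linarith
    · intro t ht
      refine boundary_flux_le (hlam i) (fun v => ?_) (G := G i) ?_
      · have h1 := dotProduct_mulVec_le_of_matLE (hlmi2 i) v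
        rwa [diagonal_mul_diagonal, ← sum_mul_sq_mulVec_eq, ← sum_mul_sq_eq_dotProduct] at h1
      · have h1 := hbc t ht
        rwa [hB0, hB1, ← mulVec_mulVec, ← mulVec_mulVec] at h1
  have hVt : Real.exp (2 * ν * t) * V t ≤ V 0 := by
    simpa using le_of_forall_free_interval (E := fun t => Real.exp (2 * ν * t) * V t)
      hfin hdecay le_rfl ht
  have hwt : ∀ t, 0 ≤ t → ContinuousOn (w t) (Icc 0 1) := fun t ht =>
    hwc.comp (f := fun x : ℝ => (t, x)) (by fun_prop) fun x hx => ⟨ht, hx⟩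
  have hintw : ∀ t, 0 ≤ t → IntervalIntegrable (fun x => ∑ k, w t x k ^ 2)
      MeasureTheory.volume 0 1 := fun t ht => by
    refine ContinuousOn.intervalIntegrable_of_Icc zero_le_one ?_
    exact Continuous.comp_continuousOn (g := fun v : Fin n → ℝ => ∑ k, v k ^ 2)
      (by fun_prop) (hwt t ht)
  have hintV : ∀ t, 0 ≤ t → IntervalIntegrable
      (fun x => ∑ k, q i₀ k * (S i₀ *ᵥ w t x) k ^ 2) MeasureTheory.volume 0 1 := fun t ht => by
    refine ContinuousOn.intervalIntegrable_of_Icc zero_le_one ?_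
    exact Continuous.comp_continuousOn
      (g := fun v : Fin n → ℝ => ∑ k, q i₀ k * (S i₀ *ᵥ v) k ^ 2) (by fun_prop) (hwt t ht)
  have hlow' : ∫ x in (0 : ℝ)..1, ∑ k, w t x k ^ 2 ≤ K₂ * V t := by
    rw [hV, ← intervalIntegral.integral_const_mul]
    refine intervalIntegral.integral_mono_on zero_le_one (hintw t ht)
      ((hintV t ht).const_mul K₂) fun x _ => ?_
    have h1 := hlow (M *ᵥ w t x)
    rwa [mulVec_mulVec, nonsing_inv_mul _ hMunit, one_mulVec, hMsq] at h1
  have hup' : V 0 ≤ K₁ * ∫ x in (0 : ℝ)..1, ∑ k, w 0 x k ^ 2 := by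
    rw [hV, ← intervalIntegral.integral_const_mul]
    refine intervalIntegral.integral_mono_on zero_le_one (hintV 0 le_rfl)
      ((hintw 0 le_rfl).const_mul K₁) fun x _ => ?_
    rw [← hMsq]
    exact hup _
  have hVt' : V t ≤ Real.exp (-ν * t) ^ 2 * V 0 := by
    have he : Real.exp (-ν * t) ^ 2 * Real.exp (2 * ν * t) = 1 := by
      rw [← Real.exp_nat_mul, ← Real.exp_add, Real.exp_eq_one_iff]
      push_cast
      ring
    calc V t = Real.exp (-ν * t) ^ 2 * (Real.exp (2 * ν * t) * V t) := by
          rw [← mul_assoc, he, one_mul]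
      _ ≤ _ := by gcongr
  rw [← Real.sqrt_sq (Real.exp_pos (-ν * t)).le, ← Real.sqrt_mul (by positivity),
    ← Real.sqrt_mul (by positivity)]
  refine Real.sqrt_le_sqrt ?_
  calc _ ≤ K₂ * V t := hlow'
    _ ≤ K₂ * (Real.exp (-ν * t) ^ 2 * (K₁ * ∫ x in (0 : ℝ)..1, ∑ k, w 0 x k ^ 2)) := by
        gcongr
        exact hVt'.trans (by gcongr)
    _ = _ := by ring
end
end
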